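/- Let X be a locally compact Hausdorff space equipped with a continuous action of a finite group W by homeomorphisms, let H be a complex Hilbert space, and suppose given unitary operators I_{w,x} ∈ B(H) for each w ∈ W and x ∈ X such that I_{w₁, w₂·x} ∘ I_{w₂, x} = I_{w₁w₂, x} for all w₁, w₂ ∈ W and x ∈ X, and such that for each w ∈ W and each ξ ∈ H the map x ↦ I_{w,x}ξ is continuous from X to H. For k ∈ C₀(X, K(H)) and w ∈ W define α_w(k)(x) = I_{w, w⁻¹·x} ∘ k(w⁻¹·x) ∘ I_{w⁻¹, x}. Then α_w(k) ∈ C₀(X, K(H)): the function α_w(k) is continuous for the operator-norm topology on B(H), vanishes in norm at infinity, and takes compact-operator values. -/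

import Mathlib

open scoped ZeroAtInfty

open Filter Topology

section StrongContinuity

variable {X H : Type*} [TopologicalSpace X] [NormedAddCommGroup H] [InnerProductSpace ℂ H]

theorem continuous_uncurry_of_norm_le_one {A : X → (H →L[ℂ] H)}
    (hA : ∀ x, ‖A x‖ ≤ 1) (hA_cont : ∀ ξ, Continuous fun x => A x ξ) :
    Continuous fun p : X × H => A p.1 p.2 := by
  refine continuous_iff_continuousAt.2 fun ⟨x₀, v₀⟩ => ?_
  have hlim : Tendsto (fun p : X × H => ‖p.2 - v₀‖ + ‖A p.1 v₀ - A x₀ v₀‖)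
      (𝓝 (x₀, v₀)) (𝓝 0) := by
    have hc : Continuous fun p : X × H => ‖p.2 - v₀‖ + ‖A p.1 v₀ - A x₀ v₀‖ := by
      have := (hA_cont v₀).comp (continuous_fst (X := X) (Y := H))
      simp only [Function.comp_def] at this
      fun_prop
    simpa using hc.tendsto (x₀, v₀)
  refine tendsto_iff_norm_sub_tendsto_zero.2 (squeeze_zero (fun _ => norm_nonneg _) ?_ hlim)
  rintro ⟨x, v⟩
  calc ‖A x v - A x₀ v₀‖ = ‖A x (v - v₀) + (A x v₀ - A x₀ v₀)‖ := by
        rw [map_sub]; congr 1; abel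
    _ ≤ ‖A x (v - v₀)‖ + ‖A x v₀ - A x₀ v₀‖ := norm_add_le _ _
    _ ≤ ‖v - v₀‖ + ‖A x v₀ - A x₀ v₀‖ := by
        gcongr
        simpa using (A x).le_of_opNorm_le (hA x) (v - v₀)

theorem IsCompactOperator.continuous_mul_of_norm_le_one {A : X → (H →L[ℂ] H)}
    (hA : ∀ x, ‖A x‖ ≤ 1) (hA_cont : ∀ ξ, Continuous fun x => A x ξ)
    {K : H →L[ℂ] H} (hK : IsCompactOperator K) :
    Continuous fun x => A x * K := by
  obtain ⟨C, hC, hKC⟩ := hK.image_closedBall_subset_compact (𝕜₁ := ℂ) (f := (K : H →ₗ[ℂ] H)) 1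
  have hjoint := continuous_uncurry_of_norm_le_one hA hA_cont
  refine continuous_iff_continuousAt.2 fun x₀ => Metric.tendsto_nhds.2 fun ε hε => ?_
  have hunif : ∀ᶠ x in 𝓝 x₀, ∀ v ∈ C, ‖A x v - A x₀ v‖ < ε / 2 := by
    refine hC.eventually_forall_of_forall_eventually fun v _ => ?_
    have hc : Continuous fun p : X × H => ‖A p.1 p.2 - A x₀ p.2‖ := by fun_prop
    exact hc.continuousAt.eventually_lt continuousAt_const (by simpa using hε)
  filter_upwards [hunif] with x hx
  rw [dist_eq_norm]
  refine lt_of_le_of_lt ?_ (half_lt_self hε)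
  refine ContinuousLinearMap.opNorm_le_of_unit_norm (𝕜 := ℂ) (half_pos hε).le fun v hv => ?_
  exact (hx (K v) (hKC ⟨v, by simp [hv], rfl⟩)).le

variable [CompleteSpace H]

theorem IsCompactOperator.continuous_mul_star_of_norm_le_one {A : X → (H →L[ℂ] H)}
    (hA : ∀ x, ‖A x‖ ≤ 1) (hA_cont : ∀ ξ, Continuous fun x => A x ξ)
    {K : H →L[ℂ] H} (hK : IsCompactOperator K) :
    Continuous fun x => K * star (A x) := by
  have hKK : IsCompactOperator (star K * K : H →L[ℂ] H) := hK.clm_comp (star K)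
  have hcont := hKK.continuous_mul_of_norm_le_one hA hA_cont
  refine continuous_iff_continuousAt.2 fun x₀ => tendsto_iff_norm_sub_tendsto_zero.2 ?_
  have hlim : Tendsto
      (fun x => √(‖A x * (star K * K) - A x₀ * (star K * K)‖ * 2)) (𝓝 x₀) (𝓝 0) := by
    have := ((tendsto_iff_norm_sub_tendsto_zero.1 (hcont.tendsto x₀)).mul_const 2).sqrt
    simpa using this
  refine squeeze_zero (fun _ => norm_nonneg _) (fun x => Real.le_sqrt_of_sq_le ?_) hlim
  have hD : ‖star (A x - A x₀)‖ ≤ 2 := by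
    rw [norm_star]
    linarith [norm_sub_le (A x) (A x₀), hA x, hA x₀]
  calc ‖K * star (A x) - K * star (A x₀)‖ ^ 2
      = ‖star (K * star (A x - A x₀)) * (K * star (A x - A x₀))‖ := by
        rw [CStarRing.norm_star_mul_self, star_sub, mul_sub, sq]
    _ = ‖(A x * (star K * K) - A x₀ * (star K * K)) * star (A x - A x₀)‖ := by
        congr 1
        rw [star_mul, star_star, ← sub_mul]
        simp only [mul_assoc]
    _ ≤ ‖A x * (star K * K) - A x₀ * (star K * K)‖ * ‖star (A x - A x₀)‖ := norm_mul_le _ _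
    _ ≤ ‖A x * (star K * K) - A x₀ * (star K * K)‖ * 2 := by gcongr

theorem continuous_conj_star_of_isCompactOperator {A K : X → (H →L[ℂ] H)}
    (hA : ∀ x, ‖A x‖ ≤ 1) (hA_cont : ∀ ξ, Continuous fun x => A x ξ)
    (hK_cont : Continuous K) (hK : ∀ x, IsCompactOperator (K x)) :
    Continuous fun x => A x * K x * star (A x) := by
  refine continuous_iff_continuousAt.2 fun x₀ => tendsto_iff_norm_sub_tendsto_zero.2 ?_
  have hlim : Tendsto (fun x => ‖K x - K x₀‖ + ‖K x₀ * star (A x) - K x₀ * star (A x₀)‖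
      + ‖A x * K x₀ - A x₀ * K x₀‖) (𝓝 x₀) (𝓝 0) := by
    have h₁ := tendsto_iff_norm_sub_tendsto_zero.1 (hK_cont.tendsto x₀)
    have h₂ := tendsto_iff_norm_sub_tendsto_zero.1
      (((hK x₀).continuous_mul_star_of_norm_le_one hA hA_cont).tendsto x₀)
    have h₃ := tendsto_iff_norm_sub_tendsto_zero.1
      (((hK x₀).continuous_mul_of_norm_le_one hA hA_cont).tendsto x₀)
    simpa using (h₁.add h₂).add h₃
  have hleft (x : X) (T : H →L[ℂ] H) : ‖A x * T‖ ≤ ‖T‖ :=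
    (norm_mul_le _ _).trans (mul_le_of_le_one_left (norm_nonneg _) (hA x))
  have hright (x : X) (T : H →L[ℂ] H) : ‖T * star (A x)‖ ≤ ‖T‖ :=
    (norm_mul_le _ _).trans
      (mul_le_of_le_one_right (norm_nonneg _) ((norm_star (A x)).trans_le (hA x)))
  refine squeeze_zero (fun _ => norm_nonneg _) (fun x => ?_) hlim
  calc ‖A x * K x * star (A x) - A x₀ * K x₀ * star (A x₀)‖
      = ‖A x * (K x - K x₀) * star (A x)
          + A x * (K x₀ * star (A x) - K x₀ * star (A x₀))
          + (A x * K x₀ - A x₀ * K x₀) * star (A x₀)‖ := by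
        congr 1
        noncomm_ring
    _ ≤ _ := norm_add₃_le
    _ ≤ _ := by
        gcongr
        · exact (hright _ _).trans (hleft _ _)
        · exact hleft _ _
        · exact hright _ _

end StrongContinuity

theorem ZeroAtInftyContinuousMap.isCompact_setOf_le_norm {X E : Type*} [TopologicalSpace X]
    [NormedAddCommGroup E] (k : C₀(X, E)) {ε : ℝ} (hε : 0 < ε) :
    IsCompact {x : X | ε ≤ ‖k x‖} := by
  have hk : Tendsto (fun x => ‖k x‖) (cocompact X) (𝓝 0) := by
    simpa using (zero_at_infty k).norm
  obtain ⟨C, hC, hCk⟩ := mem_cocompact.1 (hk.eventually_lt_const hε)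
  refine hC.of_isClosed_subset (isClosed_le continuous_const (map_continuous k).norm) ?_
  intro x (hx : ε ≤ ‖k x‖)
  by_contra hxC
  exact hx.not_gt (hCk hxC)

theorem mul_inv_smul_eq_one_of_cocycle {W X M : Type*} [Group W] [MulAction W X] [Monoid M]
    {I : W → X → M} (hI_unit : ∀ x, IsUnit (I 1 x))
    (hI_mul : ∀ w₁ w₂ x, I w₁ (w₂ • x) * I w₂ x = I (w₁ * w₂) x) (w : W) (x : X) :
    I w (w⁻¹ • x) * I w⁻¹ x = 1 := by
  have h := hI_mul 1 1 x
  rw [one_smul, one_mul] at h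
  rw [hI_mul, mul_inv_cancel]
  exact (hI_unit x).mul_eq_left.1 h

/-- Given an action of a finite group `W` on `(X, H)` — i.e. an action of `W` on the locally
compact Hausdorff space `X` by homeomorphisms, together with a strong-operator-continuous
cocycle of unitaries `I_{w,x}` on the complex Hilbert space `H` — the formula
`α_w(k)(x) = I_{w, w⁻¹x} ∘ k(w⁻¹x) ∘ I_{w⁻¹, x}` sends `C₀(X, K(H))` to itself: `α_w(k)` is
norm-continuous, vanishes in norm at infinity, and takes compact-operator values. -/
theorem alpha_w_maps_into_C0XKH
    {W : Type} [Group W] [Finite W]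
    {X : Type} [TopologicalSpace X] [LocallyCompactSpace X] [T2Space X]
    [MulAction W X] (hcont : ∀ w : W, Continuous fun x : X => w • x)
    {H : Type} [NormedAddCommGroup H] [InnerProductSpace ℂ H] [CompleteSpace H]
    (I : W → X → (H →L[ℂ] H))
    (hI_unitary : ∀ (w : W) (x : X), I w x ∈ unitary (H →L[ℂ] H))
    (hI_mul : ∀ (w₁ w₂ : W) (x : X), I w₁ (w₂ • x) * I w₂ x = I (w₁ * w₂) x)
    (hI_cont : ∀ (w : W) (ξ : H), Continuous fun x : X => I w x ξ)
    (k : C₀(X, H →L[ℂ] H)) (hk : ∀ x : X, IsCompactOperator (k x))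
    (w : W) :
    Continuous (fun x : X => I w (w⁻¹ • x) * k (w⁻¹ • x) * I w⁻¹ x) ∧
    (∀ ε : ℝ, 0 < ε →
      IsCompact {x : X | ε ≤ ‖I w (w⁻¹ • x) * k (w⁻¹ • x) * I w⁻¹ x‖}) ∧
    (∀ x : X, IsCompactOperator (I w (w⁻¹ • x) * k (w⁻¹ • x) * I w⁻¹ x)) := by
  have hU_norm (x : X) : ‖I w (w⁻¹ • x)‖ ≤ 1 := by
    rw [← mul_one (I w (w⁻¹ • x)), CStarRing.norm_mem_unitary_mul _ (hI_unitary _ _)]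
    exact ContinuousLinearMap.norm_id_le
  have hstar (x : X) : I w⁻¹ x = star (I w (w⁻¹ • x)) := by
    refine (left_inv_eq_right_inv (Unitary.star_mul_self_of_mem (hI_unitary _ _)) ?_).symm
    exact mul_inv_smul_eq_one_of_cocycle
      (fun y => (Unitary.toUnits ⟨I 1 y, hI_unitary 1 y⟩).isUnit) hI_mul w x
  refine ⟨?_, fun ε hε => ?_, fun x => ?_⟩
  · simp only [hstar]
    exact continuous_conj_star_of_isCompactOperator hU_norm
      (fun ξ => (hI_cont w ξ).comp (hcont w⁻¹)) ((map_continuous k).comp (hcont w⁻¹))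
      (fun x => hk _)
  · have himage := (k.isCompact_setOf_le_norm hε).image (hcont w)
    convert himage using 1
    ext x
    rw [Set.image_smul, Set.mem_smul_set_iff_inv_smul_mem, Set.mem_ofPred_eq, Set.mem_ofPred_eq,
      CStarRing.norm_mul_mem_unitary _ (hI_unitary _ _),
      CStarRing.norm_mem_unitary_mul _ (hI_unitary _ _)]
  · exact ((hk _).clm_comp (I w (w⁻¹ • x))).comp_clm (I w⁻¹ x)
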